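/- For every integer q ≥ 2 and every collection of q distinct points of T², there exist two distinct points among them whose distance is less than 2/√(πq). -/

import Mathlib

noncomputable section

open Metric Set Filter Topology MeasureTheory Pointwise

/-- The plane `ℝ²` with the Euclidean metric. -/
abbrev R2 : Type := EuclideanSpace ℝ (Fin 2)

/-- The integer lattice `ℤ² ⊂ ℝ²`. -/
def intLattice : AddSubgroup R2 where
  carrier := {v : R2 | ∀ i, ∃ n : ℤ, v i = (n : ℝ)}
  add_mem' := by
    intro a b ha hb i
    obtain ⟨m, hm⟩ := ha i
    obtain ⟨n, hn⟩ := hb i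
    exact ⟨m + n, by push_cast; rw [← hm, ← hn]; rfl⟩
  zero_mem' := fun i => ⟨0, by simp⟩
  neg_mem' := by
    intro a ha i
    obtain ⟨m, hm⟩ := ha i
    exact ⟨-m, by push_cast; rw [← hm]; rfl⟩

/-- The torus `T² = ℝ²/ℤ²`, with the quotient (Euclidean) metric. -/
abbrev T2 : Type := R2 ⧸ intLattice

/-- The covering projection `π : ℝ² → T²`. -/
def pr : R2 → T2 := QuotientAddGroup.mk

instance : MeasurableSpace T2 := borel T2
instance : BorelSpace T2 := ⟨rfl⟩

/-- A fundamental domain `[0,1)²` for the lattice action. -/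
def fundDomain : Set R2 := {x : R2 | ∀ i, x i ∈ Set.Ico (0 : ℝ) 1}

/-- Lebesgue (Haar) probability measure on the torus `T²`. -/
def lebT2 : Measure T2 := Measure.map pr (volume.restrict fundDomain)

/-- `F : ℝ² → ℝ²` is a lift of `f : T² → T²` if `π ∘ F = f ∘ π` and
`F (x + w) = F x + w` for every lattice vector `w ∈ ℤ²`. -/
structure IsLift (f : T2 ≃ₜ T2) (F : R2 ≃ₜ R2) : Prop where
  proj : ∀ x : R2, pr (F x) = f (pr x)
  equivariant : ∀ x : R2, ∀ w ∈ intLattice, F (x + w) = F x + w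

/-- `Homeo₀(T²)`: homeomorphisms of the torus isotopic to the identity,
characterized as those admitting a lift commuting with integer translations. -/
def Homeo0 : Set (T2 ≃ₜ T2) := {f | ∃ F : R2 ≃ₜ R2, IsLift f F}

/-- `Homeo_{0,λ}(T²)`: elements of `Homeo₀(T²)` preserving Lebesgue measure. -/
def Homeo0Leb : Set (T2 ≃ₜ T2) :=
  {f | f ∈ Homeo0 ∧ MeasurePreserving f lebT2 lebT2}

/-- The uniform `C⁰` distance `d_{C⁰}(f,g) = sup_x d(f(x), g(x))` on torus maps. -/
def dC0 (f g : T2 ≃ₜ T2) : ℝ := ⨆ x : T2, dist (f x) (g x)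

/-- The uniform distance `sup_{x ∈ ℝ²} ‖F(x) − G(x)‖` between maps of the plane. -/
def supDist (F G : R2 → R2) : ℝ := ⨆ x : R2, dist (F x) (G x)

/-- The rotation set `ρ(F̃)` of a lift: all limits `(F̃^{n_k}(z_k) − z_k)/n_k`. -/
def rotSet (F : R2 ≃ₜ R2) : Set R2 :=
  {v | ∃ (z : ℕ → R2) (n : ℕ → ℕ), Tendsto n atTop atTop ∧
    Tendsto (fun k => (n k : ℝ)⁻¹ • ((⇑F)^[n k] (z k) - z k)) atTop (𝓝 v)}

/-- The rotation set of `f`, with fixed lift `F`, is `δ`-upper-stable in `H`. -/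
def UpperStable (H : Set (T2 ≃ₜ T2)) (F : R2 ≃ₜ R2) (δ : ℝ) : Prop :=
  ∀ g ∈ H, ∀ G : R2 ≃ₜ R2, IsLift g G → supDist (⇑F) (⇑G) < δ →
    rotSet G ⊆ rotSet F

/-- The rotation set of `f`, with fixed lift `F`, is `δ`-stable in `H`. -/
def StableRS (H : Set (T2 ≃ₜ T2)) (F : R2 ≃ₜ R2) (δ : ℝ) : Prop :=
  ∀ g ∈ H, ∀ G : R2 ≃ₜ R2, IsLift g G → supDist (⇑F) (⇑G) < δ →
    rotSet G = rotSet F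

/-- `f` has a stable rotation set in `H`. -/
def HasStableRotSet (H : Set (T2 ≃ₜ T2)) (f : T2 ≃ₜ T2) : Prop :=
  ∃ F : R2 ≃ₜ R2, IsLift f F ∧ ∃ δ > 0, StableRS H F δ

/-- `S` is open in `H` for the uniform `C⁰` topology. -/
def OpenIn (H S : Set (T2 ≃ₜ T2)) : Prop :=
  ∀ f ∈ S ∩ H, ∃ δ > 0, ∀ g ∈ H, dC0 f g < δ → g ∈ S

/-- `S` is dense in `H` for the uniform `C⁰` topology. -/
def DenseIn (H S : Set (T2 ≃ₜ T2)) : Prop :=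
  ∀ f ∈ H, ∀ ε > 0, ∃ g ∈ S ∩ H, dC0 f g < ε

/-- `(x_i)_{0 ≤ i ≤ n}` is a finite `ε`-pseudo-orbit of `F`. -/
def IsPseudoOrbitUpTo (F : R2 → R2) (ε : ℝ) (x : ℕ → R2) (n : ℕ) : Prop :=
  ∀ i < n, dist (F (x i)) (x (i + 1)) < ε

/-- `(x_i)_{i ∈ ℕ}` is an infinite `ε`-pseudo-orbit of `F`. -/
def IsPseudoOrbit (F : R2 → R2) (ε : ℝ) (x : ℕ → R2) : Prop :=
  ∀ i : ℕ, dist (F (x i)) (x (i + 1)) < ε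

/-- The `ε`-pseudo-rotation set `ρ_ε(F̃)`. -/
def pseudoRotSet (F : R2 → R2) (ε : ℝ) : Set R2 :=
  {v | ∃ (n : ℕ → ℕ) (x : ℕ → ℕ → R2), Tendsto n atTop atTop ∧
    (∀ k, IsPseudoOrbitUpTo F ε (x k) (n k)) ∧
    Tendsto (fun k => (n k : ℝ)⁻¹ • (x k (n k) - x k 0)) atTop (𝓝 v)}

/-- The oscillation `osc(f) = sup_{x,y} ‖(F(x) − x) − (F(y) − y)‖` of a lift. -/
def osc (F : R2 → R2) : ℝ := ⨆ p : R2 × R2, ‖(F p.1 - p.1) - (F p.2 - p.2)‖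

/-- `f` has the shadowing property. -/
def Shadowing (f : T2 ≃ₜ T2) : Prop :=
  ∀ ε > 0, ∃ δ > 0, ∀ x : ℕ → T2, (∀ i, dist (f (x i)) (x (i + 1)) < δ) →
    ∃ z : T2, ∀ i, dist ((⇑f)^[i] z) (x i) < ε

/-- `v ∈ ℚ² ⊂ ℝ²`. -/
def IsRationalPoint (v : R2) : Prop := ∀ i, ∃ q : ℚ, v i = (q : ℝ)


lemma lat_norm {a : R2} (ha : a ∈ intLattice) (h0 : a ≠ 0) : 1 ≤ ‖a‖ := by
  have : ∃ i, a i ≠ 0 := by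
    by_contra! h
    exact h0 (by ext i; simpa using h i)
  obtain ⟨i, hi⟩ := this
  obtain ⟨n, hn⟩ := ha i
  have h1 : (1 : ℝ) ≤ |a i| := by
    have hn0 : n ≠ 0 := by
      rintro rfl
      exact hi (by rw [hn]; exact Int.cast_zero)
    have h2 : (1 : ℝ) ≤ |(n : ℝ)| := by exact_mod_cast Int.one_le_abs hn0
    rw [hn]; exact h2
  exact h1.trans (by simpa using PiLp.norm_apply_le a i)

lemma lat_closed : IsClosed (intLattice : Set R2) := by
  have : (intLattice : Set R2) = ⋂ i, (fun v : R2 => v i) ⁻¹' (range ((↑) : ℤ → ℝ)) := by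
    ext v
    simp only [SetLike.mem_coe, mem_iInter, mem_preimage, mem_range]
    exact forall_congr' fun i => exists_congr fun n => eq_comm
  rw [this]
  refine isClosed_iInter fun i => ?_
  exact Int.isClosedEmbedding_coe_real.isClosed_range.preimage (by fun_prop)

lemma lat_countable : Countable intLattice := by
  let f : intLattice → (Fin 2 → ℤ) := fun v i => (v.2 i).choose
  refine Function.Injective.countable (f := f) ?_
  intro v w h
  ext i
  have h1 := (v.2 i).choose_spec
  have h2 := (w.2 i).choose_spec
  have h3 : (v.2 i).choose = (w.2 i).choose := congrFun h i
  rw [h1, h2, h3]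

lemma fund_vol : volume fundDomain = 1 := by
  have h := (PiLp.volume_preserving_toLp (Fin 2)).measure_preimage_equiv
    (f := MeasurableEquiv.toLp 2 (Fin 2 → ℝ)) fundDomain
  rw [← h]
  have : (MeasurableEquiv.toLp 2 (Fin 2 → ℝ)) ⁻¹' fundDomain
      = Set.pi univ (fun _ => Ico (0 : ℝ) 1) := by
    ext v
    simp [fundDomain, Set.mem_pi]
  rw [this, Real.volume_pi_Ico]
  simp

lemma fund_meas : MeasurableSet fundDomain := by
  have : fundDomain = ⋂ i, (fun v : R2 => v i) ⁻¹' (Ico (0 : ℝ) 1) := by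
    ext v; simp [fundDomain]
  rw [this]
  exact MeasurableSet.iInter fun i => measurableSet_Ico.preimage (by fun_prop)

lemma fund_dom : IsAddFundamentalDomain intLattice fundDomain (volume : Measure R2) := by
  refine IsAddFundamentalDomain.mk' fund_meas.nullMeasurableSet ?_
  intro x
  refine ⟨⟨WithLp.toLp 2 (fun i => ((-⌊x i⌋ : ℤ) : ℝ)), fun i => ⟨-⌊x i⌋, rfl⟩⟩, ?_, ?_⟩
  · intro i
    have h1 := Int.floor_le (x i)
    have h2 := Int.lt_floor_add_one (x i)
    simp only [AddSubgroup.vadd_def, vadd_eq_add, PiLp.add_apply, Int.cast_neg, mem_Ico]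
    constructor <;> linarith
  · rintro ⟨g, hg⟩ h
    ext i
    obtain ⟨n, hn⟩ := hg i
    have hi := h i
    simp only [AddSubgroup.vadd_def, vadd_eq_add, PiLp.add_apply, mem_Ico] at hi
    rw [hn] at hi
    have : ⌊x i⌋ = -n := by
      rw [Int.floor_eq_iff]; push_cast; constructor <;> linarith [hi.1, hi.2]
    change g i = ((-⌊x i⌋ : ℤ) : ℝ)
    rw [hn, this, neg_neg]

lemma packing {ι : Type} [Fintype ι] (c : ι → R2) (ρ : ι → ℝ)
    (sep : ∀ k l, ∀ a ∈ intLattice, (k ≠ l ∨ a ≠ 0) → ρ k + ρ l ≤ ‖c k - c l - a‖) :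
    ∑ k, volume (ball (c k) (ρ k)) ≤ 1 := by
  have key : ∀ k l, ∀ a ∈ intLattice, (k ≠ l ∨ a ≠ 0) → ∀ u ∈ ball (c k) (ρ k),
      ∀ v ∈ ball (c l) (ρ l), u ≠ v + a := by
    intro k l a ha h u hu v hv huv
    have h1 := sep k l a ha h
    rw [mem_ball_iff_norm] at hu hv
    have : c k - c l - a = (v - c l) - (u - c k) := by rw [huv]; abel
    rw [this] at h1
    linarith [norm_sub_le (v - c l) (u - c k)]
  have hd : Pairwise (Function.onFun Disjoint fun k => ball (c k) (ρ k)) := by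
    intro k l hkl
    refine disjoint_left.2 fun u hu hv => ?_
    exact key k l 0 intLattice.zero_mem (Or.inl hkl) u hu u hv (by simp)
  have hs : ∑ k, volume (ball (c k) (ρ k)) = volume (⋃ k, ball (c k) (ρ k)) := by
    rw [measure_iUnion hd (fun k => measurableSet_ball), tsum_fintype]
  rw [hs]
  by_contra! hlt
  rw [← fund_vol] at hlt
  haveI := lat_countable
  obtain ⟨a, b, hab, hnd⟩ := exists_pair_mem_lattice_not_disjoint_vadd fund_dom
    (MeasurableSet.iUnion fun k => measurableSet_ball).nullMeasurableSet hlt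
  apply hnd
  refine disjoint_left.2 ?_
  rintro _ ⟨u, hu, rfl⟩ ⟨v, hv, huv⟩
  rw [mem_iUnion] at hu hv
  obtain ⟨k, hk⟩ := hu
  obtain ⟨l, hl⟩ := hv
  simp only [AddSubgroup.vadd_def, vadd_eq_add] at huv
  refine key k l ((b : R2) - a) (intLattice.sub_mem b.2 a.2) (Or.inr ?_) u hk v hl ?_
  · intro h
    exact hab (Subtype.ext (sub_eq_zero.1 h).symm)
  · have : u = (a : R2) + u - a := by abel
    rw [this, ← huv]; abel

lemma dist_attained (y y' : R2) :
    ∃ a ∈ intLattice, dist (y : T2) (y' : T2) = ‖y - y' - a‖ := by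
  obtain ⟨a, ha, h⟩ := lat_closed.exists_infDist_eq_dist ⟨0, intLattice.zero_mem⟩ (y - y')
  refine ⟨a, ha, ?_⟩
  rw [dist_eq_norm, ← QuotientAddGroup.mk_sub, QuotientAddGroup.norm_mk, h, dist_eq_norm]

lemma dist_le_lat (y y' : R2) {a : R2} (ha : a ∈ intLattice) :
    dist (y : T2) (y' : T2) ≤ ‖y - y' - a‖ := by
  rw [dist_eq_norm, ← QuotientAddGroup.mk_sub, QuotientAddGroup.norm_mk, ← dist_eq_norm]
  exact infDist_le_dist_of_mem ha

lemma exists_dir (C : Set R2) (hC : C.Countable) : ∃ e : R2, ‖e‖ = 1 ∧ e ∉ C := by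
  have h1 : ¬ (Ioo (0 : ℝ) 1).Countable := by
    rw [Cardinal.Real.Ioo_countable_iff]; norm_num
  have h2 : ((fun v : R2 => v 0) '' C).Countable := hC.image _
  have : ∃ t ∈ Ioo (0 : ℝ) 1, t ∉ ((fun v : R2 => v 0) '' C) := by
    by_contra! h
    exact h1 (h2.mono h)
  obtain ⟨t, ht, htC⟩ := this
  refine ⟨!₂[t, √(1 - t ^ 2)], ?_, fun h => htC ⟨_, h, by simp⟩⟩
  have : 0 ≤ 1 - t ^ 2 := by nlinarith [ht.1, ht.2]
  simp [EuclideanSpace.norm_eq, Fin.sum_univ_two, Real.sq_sqrt this]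

lemma exists_hole {q : ℕ} (y : Fin q → R2) (i₀ : Fin q) {r : ℝ} (hr : 0 < r) (hr2 : 2 * r < 1)
    (H : ∀ i j, i ≠ j → 2 * r ≤ dist (y i : T2) (y j : T2)) :
    ∃ z : R2, ∃ η > 0, 2 * η ≤ 1 ∧ ∀ i, ∀ a ∈ intLattice, r + η ≤ ‖z - y i - a‖ := by
  haveI := lat_countable
  obtain ⟨e, he, heC⟩ := exists_dir
    (range fun p : Fin q × intLattice => (2 * r)⁻¹ • (y p.1 + (p.2 : R2) - y i₀))
    (countable_range _)
  have hz : ∀ j, j ≠ i₀ → r < dist ((y i₀ + r • e : R2) : T2) (y j : T2) := by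
    intro j hj
    by_contra! hle
    obtain ⟨a, ha, hda⟩ := dist_attained (y i₀ + r • e) (y j)
    rw [hda] at hle
    have h1 := (H i₀ j hj.symm).trans (dist_le_lat (y i₀) (y j) ha)
    apply heC
    refine ⟨(j, ⟨a, ha⟩), ?_⟩
    simp only
    set w := y j + a - y i₀ with hw
    have e1 : y i₀ + r • e - y j - a = r • e - w := by rw [hw]; abel
    have e2 : y i₀ - y j - a = -w := by rw [hw]; abel
    rw [e1] at hle
    rw [e2, norm_neg] at h1
    have key : ‖w - (2 * r) • e‖ ^ 2 ≤ 0 := by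
      have a1 := norm_sub_sq_real w ((2 * r) • e)
      have a2 := norm_sub_sq_real (r • e) w
      rw [inner_smul_right, norm_smul, he, Real.norm_of_nonneg (by positivity)] at a1
      rw [inner_smul_left, norm_smul, he, Real.norm_of_nonneg hr.le, real_inner_comm] at a2
      simp only [conj_trivial] at a2
      have : ‖r • e - w‖ ^ 2 ≤ r ^ 2 := by
        exact pow_le_pow_left₀ (norm_nonneg _) hle 2
      nlinarith
    have : w - (2 * r) • e = 0 := by
      rw [← norm_eq_zero]
      exact pow_eq_zero_iff (two_ne_zero) |>.1 (le_antisymm key (sq_nonneg _))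
    rw [sub_eq_zero.1 this, smul_smul, inv_mul_cancel₀ (by positivity), one_smul]
  have hev : ∀ᶠ η : ℝ in 𝓝[>] 0, (3 * η < 1 - 2 * r) ∧
      ∀ j, j ≠ i₀ → 3 * η < dist ((y i₀ + r • e : R2) : T2) (y j : T2) - r := by
    have hs : ∀ s : ℝ, 0 < s → ∀ᶠ η : ℝ in 𝓝[>] 0, 3 * η < s := by
      intro s hs
      filter_upwards [Ioo_mem_nhdsGT (show (0:ℝ) < s / 3 by positivity)] with η hη
      linarith [hη.2]
    refine (hs _ (by linarith)).and (eventually_all.2 fun j => ?_)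
    by_cases hj : j = i₀
    · simp [hj]
    · filter_upwards [hs _ (sub_pos.2 (hz j hj))] with η hη _ using hη
  obtain ⟨η, ⟨hη1, hη2⟩, hη⟩ := (hev.and self_mem_nhdsWithin).exists
  have hη : 0 < η := hη
  have nrm : ∀ s : ℝ, 0 ≤ s → ‖s • e‖ = s := fun s hs => by
    rw [norm_smul, he, Real.norm_of_nonneg hs, mul_one]
  refine ⟨y i₀ + (r + 2 * η) • e, η, hη, by linarith, ?_⟩
  intro j a ha
  by_cases hj : j = i₀
  · subst hj
    rw [add_sub_cancel_left]
    by_cases h0 : a = 0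
    · rw [h0, sub_zero, nrm _ (by positivity)]; linarith
    · have := lat_norm ha h0
      have h2 := norm_sub_norm_le a ((r + 2 * η) • e)
      rw [norm_sub_rev, nrm _ (by positivity)] at h2
      linarith
  · have h1 := hη2 j hj
    have h2 := dist_le_lat (y i₀ + r • e) (y j) ha
    have e1 : y i₀ + r • e - y j - a = (y i₀ + (r + 2 * η) • e - y j - a) - (2 * η) • e := by
      rw [add_smul]; abel
    rw [e1] at h2
    have h3 := norm_sub_le (y i₀ + (r + 2 * η) • e - y j - a) ((2 * η) • e)
    rw [nrm (2 * η) (by positivity)] at h3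
    linarith

/-- For every `q ≥ 2` and every `q` distinct points of `T²`, two of them
are at distance less than `2/√(πq)`. -/
theorem exists_close_pair_on_torus (q : ℕ) (hq : 2 ≤ q) (x : Fin q → T2)
    (hx : Function.Injective x) :
    ∃ i j : Fin q, i ≠ j ∧ dist (x i) (x j) < 2 / Real.sqrt (Real.pi * (q : ℝ)) := by
  by_contra! hcon
  have hq0 : (2 : ℝ) ≤ q := by exact_mod_cast hq
  have hpi := Real.pi_gt_three
  set r : ℝ := 1 / Real.sqrt (Real.pi * (q : ℝ)) with hrdef
  have hpq : 4 < Real.pi * (q : ℝ) := by nlinarith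
  have hsq : 0 < Real.sqrt (Real.pi * (q : ℝ)) := Real.sqrt_pos.2 (by linarith)
  have hr : 0 < r := by positivity
  have hr2 : 2 * r < 1 := by
    have : 2 < Real.sqrt (Real.pi * (q : ℝ)) := by
      rw [Real.lt_sqrt (by norm_num)]; linarith
    rw [hrdef, mul_one_div, div_lt_one hsq]; exact this
  choose y hy using fun i => QuotientAddGroup.mk_surjective (s := intLattice) (x i)
  have H : ∀ i j, i ≠ j → 2 * r ≤ dist (y i : T2) (y j : T2) := by
    intro i j hij
    have := hcon i j hij
    rw [hy, hy, hrdef, mul_one_div]; exact this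
  obtain ⟨z, η, hη, hη1, hz⟩ := exists_hole y ⟨0, by omega⟩ hr hr2 H
  have hp := packing (fun k : Option (Fin q) => k.elim z y) (fun k => k.elim η fun _ => r) (by
    rintro (_ | i) (_ | j) a ha h
    · simp only [ne_eq, not_true_eq_false, false_or] at h
      have := lat_norm ha h
      simp only [Option.elim_none, sub_self, zero_sub, norm_neg]
      linarith
    · have := hz j a ha
      simp only [Option.elim_none, Option.elim_some]
      linarith
    · have := hz i (-a) (intLattice.neg_mem ha)
      simp only [Option.elim_none, Option.elim_some]
      rw [← norm_neg]
      have e : -(y i - z - a) = z - y i - -a := by abel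
      rw [e]
      linarith
    · simp only [Option.elim_some]
      by_cases hij : i = j
      · subst hij
        simp only [ne_eq, not_true_eq_false, false_or] at h
        have := lat_norm ha h
        simp only [sub_self, zero_sub, norm_neg]
        linarith
      · have := (H i j hij).trans (dist_le_lat (y i) (y j) ha)
        linarith)
  rw [Fintype.sum_option] at hp
  simp only [Option.elim_none, Option.elim_some] at hp
  have hv : ∑ i, volume (ball (y i) r) = 1 := by
    simp only [EuclideanSpace.volume_ball_fin_two, Finset.sum_const, Finset.card_univ,
      Fintype.card_fin, nsmul_eq_mul]
    rw [← ENNReal.ofReal_pow hr.le, ← ENNReal.ofReal_mul (by positivity),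
      ← ENNReal.ofReal_natCast, ← ENNReal.ofReal_mul (by positivity), ← ENNReal.ofReal_one]
    congr 1
    rw [hrdef, div_pow, Real.sq_sqrt (by linarith)]
    have : (q : ℝ) ≠ 0 := by linarith
    field_simp
  rw [hv] at hp
  have hpos : 0 < volume (ball z η) := measure_ball_pos _ _ hη
  exact absurd hp (not_le.2 (by
    rw [add_comm]
    exact ENNReal.lt_add_right ENNReal.one_ne_top hpos.ne'))
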